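/- If every graph with at most k−1 vertices of degree less than three and at least f(k−1) vertices contains two cycles of lengths differing by one or two, then every 2-connected graph G with exactly k vertices of degree at most two, no two cycles of lengths differing by one or two, and at least f(k−1)+1 vertices contains an induced cycle C such that G − V(C) is connected. -/

import Mathlib

/-- A graph has a *good pair* of cycles if it contains two cycles whose
lengths differ by one or two. -/
def HasGoodPair {V : Type*} (G : SimpleGraph V) : Prop :=
  ∃ (u v : V) (c₁ : G.Walk u u) (c₂ : G.Walk v v),
    c₁.IsCycle ∧ c₂.IsCycle ∧
      (c₁.length + 1 = c₂.length ∨ c₁.length + 2 = c₂.length)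

/-- A graph is 2-connected if it has at least 3 vertices and remains connected
after deleting any single vertex. -/
def TwoConnected {V : Type*} [Fintype V] (G : SimpleGraph V) : Prop :=
  3 ≤ Fintype.card V ∧ ∀ v : V, (G.induce {u | u ≠ v}).Connected


/-- number of neighbours of `v` inside `F` -/
def dIn {V : Type} (G : SimpleGraph V) [DecidableRel G.Adj] (F : Finset V) (v : V) : ℕ :=
  (F.filter (fun u => G.Adj v u)).card

lemma acyclic_edges {W : Type} [Fintype W] [Nonempty W] (H : SimpleGraph W)
    [DecidableRel H.Adj] (h : H.IsAcyclic) : H.edgeFinset.card + 1 ≤ Fintype.card W := by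
  classical
  obtain ⟨T, hT, -, ht⟩ := (SimpleGraph.connected_top (V := W)).exists_isTree_le_of_le_of_isAcyclic
    le_top h
  have h1 := ht.card_edgeFinset
  have h2 : H.edgeFinset.card ≤ T.edgeFinset.card :=
    Finset.card_le_card (SimpleGraph.edgeFinset_mono hT)
  omega

lemma degree_induce_eq {V : Type} [Fintype V] [DecidableEq V] (G : SimpleGraph V)
    [DecidableRel G.Adj] (s : Set V) [Fintype s] (S : Finset V) (hS : ∀ x, x ∈ s ↔ x ∈ S)
    (v : s) [Fintype ((G.induce s).neighborSet v)] :
    (G.induce s).degree v = dIn G S v := by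
  unfold dIn
  rw [← SimpleGraph.card_neighborFinset_eq_degree, ← Finset.card_map (Function.Embedding.subtype (· ∈ s))]
  congr 1
  ext x
  simp only [Finset.mem_map, SimpleGraph.mem_neighborFinset, Finset.mem_filter]
  constructor
  · rintro ⟨y, hy, rfl⟩
    exact ⟨(hS _).1 y.2, hy⟩
  · rintro ⟨h1, h2⟩
    exact ⟨⟨x, (hS _).2 h1⟩, h2, rfl⟩

lemma dIn_univ {V : Type} [Fintype V] [DecidableEq V] (G : SimpleGraph V)
    [DecidableRel G.Adj] (v : V) : dIn G Finset.univ v = G.degree v := by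
  unfold dIn
  rw [← SimpleGraph.card_neighborFinset_eq_degree]
  congr 1
  ext x
  simp

lemma sum_dIn_le {V : Type} [Fintype V] [DecidableEq V] (G : SimpleGraph V)
    [DecidableRel G.Adj] (S : Finset V) (hne : S.Nonempty)
    (h : (G.induce (S : Set V)).IsAcyclic) : ∑ v ∈ S, dIn G S v + 2 ≤ 2 * S.card := by
  classical
  obtain ⟨a, ha⟩ := hne
  have : Nonempty (S : Set V) := ⟨⟨a, by simpa using ha⟩⟩
  have h1 := acyclic_edges _ h
  have h2 := (G.induce (S : Set V)).sum_degrees_eq_twice_card_edges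
  have h3 : ∑ v, (G.induce (S : Set V)).degree v = ∑ v ∈ S, dIn G S v := by
    rw [← Finset.sum_coe_sort S]
    exact Finset.sum_congr rfl fun v _ => degree_induce_eq G _ S (by simp) v
  have h4 : Fintype.card (S : Set V) = S.card := by simp
  rw [h4] at h1
  rw [h3] at h2
  omega

lemma dIn_erase {V : Type} [DecidableEq V] (G : SimpleGraph V)
    [DecidableRel G.Adj] (F : Finset V) (h : V) (hF : h ∈ F) (v : V) :
    dIn G F v = dIn G (F.erase h) v + (if G.Adj h v then 1 else 0) := by
  unfold dIn
  rw [Finset.filter_erase]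
  split_ifs with hv
  · rw [Finset.card_erase_add_one]
    simp [hF, hv.symm]
  · rw [Finset.erase_eq_of_notMem]
    · rfl
    · simp [hF, G.adj_comm, hv]

lemma sum_erase {V : Type} [Fintype V] [DecidableEq V] (G : SimpleGraph V)
    [DecidableRel G.Adj] (F : Finset V) (h a : V) (hF : h ∈ F) (haF : a ∈ F) (ha : a ≠ h)
    (hac : (G.induce ((F.erase h : Finset V) : Set V)).IsAcyclic) :
    ∑ v ∈ F.erase h, dIn G F v + 4 ≤ 2 * F.card + dIn G F h := by
  have h1 := sum_dIn_le G (F.erase h) ⟨a, by simp [ha, haF]⟩ hac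
  rw [Finset.card_erase_of_mem hF] at h1
  rw [Finset.sum_congr rfl (fun v _ => dIn_erase G F h hF v), Finset.sum_add_distrib,
    ← Finset.card_filter]
  have h3 : ((F.erase h).filter (fun v => G.Adj h v)).card = dIn G F h := by
    unfold dIn
    congr 1
    ext x
    simp only [Finset.mem_filter, Finset.mem_erase]
    constructor
    · tauto
    · rintro ⟨hx, hh⟩
      exact ⟨⟨hh.ne', hx⟩, hh⟩
  have : 0 < F.card := Finset.card_pos.2 ⟨h, hF⟩
  omega

lemma excess_one {V : Type} [Fintype V] [DecidableEq V] (G : SimpleGraph V)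
    [DecidableRel G.Adj] (F : Finset V) (hd : ∀ v ∈ F, 2 ≤ dIn G F v)
    (h a : V) (hF : h ∈ F) (haF : a ∈ F) (ha : a ≠ h)
    (hac : (G.induce ((F.erase h : Finset V) : Set V)).IsAcyclic) :
    dIn G F a ≤ dIn G F h := by
  have h1 := sum_erase G F h a hF haF ha hac
  have hm : a ∈ F.erase h := by simp [ha, haF]
  rw [← Finset.add_sum_erase _ _ hm] at h1
  have h2 := Finset.card_nsmul_le_sum ((F.erase h).erase a) (fun v => dIn G F v) 2
    (fun v hv => hd v (by simp at hv; tauto))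
  have h3 := Finset.card_erase_add_one hm
  have h4 := Finset.card_erase_add_one hF
  simp only [smul_eq_mul] at h2
  omega

lemma excess_two {V : Type} [Fintype V] [DecidableEq V] (G : SimpleGraph V)
    [DecidableRel G.Adj] (F : Finset V) (hd : ∀ v ∈ F, 2 ≤ dIn G F v)
    (h a b : V) (hF : h ∈ F) (haF : a ∈ F) (ha : a ≠ h) (hbF : b ∈ F) (hb : b ≠ h) (hab : a ≠ b)
    (hac : (G.induce ((F.erase h : Finset V) : Set V)).IsAcyclic) :
    dIn G F a + dIn G F b ≤ dIn G F h + 2 := by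
  have h1 := sum_erase G F h a hF haF ha hac
  have hm : a ∈ F.erase h := by simp [ha, haF]
  have hm' : b ∈ (F.erase h).erase a := by simp [hb, hbF, hab.symm]
  rw [← Finset.add_sum_erase _ _ hm, ← Finset.add_sum_erase _ _ hm'] at h1
  have h2 := Finset.card_nsmul_le_sum (((F.erase h).erase a).erase b) (fun v => dIn G F v) 2
    (fun v hv => hd v (by simp at hv; tauto))
  have h3 := Finset.card_erase_add_one hm
  have h4 := Finset.card_erase_add_one hF
  have h5 := Finset.card_erase_add_one hm'
  simp only [smul_eq_mul] at h2
  omega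

lemma boundary_edge {V : Type} [Fintype V] (G : SimpleGraph V) (h2 : TwoConnected G)
    (A : Set V) (v a b : V) (ha : a ∈ A) (hav : a ≠ v) (hb : b ∉ A) (hbv : b ≠ v) :
    ∃ x y, x ∈ A ∧ y ∉ A ∧ x ≠ v ∧ y ≠ v ∧ G.Adj x y := by
  obtain ⟨p⟩ := (h2.2 v).preconnected ⟨a, hav⟩ ⟨b, hbv⟩
  obtain ⟨d, -, h3, h4⟩ := p.exists_boundary_dart {x | (x : V) ∈ A} ha hb
  exact ⟨d.fst, d.snd, h3, h4, d.fst.2, d.snd.2, d.adj⟩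

lemma two_le_degree {V : Type} [Fintype V] [DecidableEq V] (G : SimpleGraph V)
    [DecidableRel G.Adj] (h2 : TwoConnected G) (v : V) : 2 ≤ G.degree v := by
  have hc := h2.1
  rw [← Finset.card_univ] at hc
  have key : ∀ u, u ≠ v → ∃ y, y ≠ u ∧ G.Adj v y := by
    intro u hu
    obtain ⟨b, hb⟩ : ∃ b, b ∉ ({u, v} : Finset V) := by
      by_contra! hh
      have := Finset.card_le_card (fun x _ => hh x : Finset.univ ⊆ ({u, v} : Finset V))
      have := Finset.card_le_two (a := u) (b := v)
      omega
    simp only [Finset.mem_insert, Finset.mem_singleton, not_or] at hb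
    obtain ⟨x, y, hx, hy, h3, h4, h5⟩ := boundary_edge G h2 {v} u v b rfl hu.symm hb.2 hb.1
    cases hx
    exact ⟨y, h4, h5⟩
  obtain ⟨b, hb⟩ : ∃ b, b ≠ v := by
    by_contra! hh
    have := Finset.card_le_card (fun x _ => by simp [hh x] : Finset.univ ⊆ ({v} : Finset V))
    simp at this
    simp at hc
    omega
  obtain ⟨y, hy, hy2⟩ := key b hb
  obtain ⟨z, hz, hz2⟩ := key y hy2.ne'
  rw [← SimpleGraph.card_neighborFinset_eq_degree]
  exact Finset.one_lt_card.2 ⟨y, by simpa using hy2, z, by simpa using hz2, hz.symm⟩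

lemma goodPair_induce {V : Type} (G : SimpleGraph V) (s : Set V)
    (h : HasGoodPair (G.induce s)) : HasGoodPair G := by
  obtain ⟨u, v, c₁, c₂, h1, h2, h3⟩ := h
  refine ⟨_, _, c₁.map (SimpleGraph.Embedding.induce s).toHom,
    c₂.map (SimpleGraph.Embedding.induce s).toHom, ?_, ?_, ?_⟩
  · exact (SimpleGraph.Walk.isCycle_map_iff_of_injective Subtype.val_injective).2 h1
  · exact (SimpleGraph.Walk.isCycle_map_iff_of_injective Subtype.val_injective).2 h2
  · rw [SimpleGraph.Walk.length_map, SimpleGraph.Walk.length_map]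
    exact h3

lemma not_goodPair_bot (W : Type) : ¬ HasGoodPair (⊥ : SimpleGraph W) := by
  rintro ⟨u, v, c, _, hc, _⟩
  exact SimpleGraph.isAcyclic_bot c hc

lemma exists_cycle_of_not_acyclic {V : Type} (G : SimpleGraph V) (s : Set V)
    (h : ¬ (G.induce s).IsAcyclic) :
    ∃ (v : V) (c : G.Walk v v), c.IsCycle ∧ ∀ x ∈ c.support, x ∈ s := by
  unfold SimpleGraph.IsAcyclic at h
  push Not at h
  obtain ⟨v, c, hc⟩ := h
  refine ⟨_, c.map (SimpleGraph.Embedding.induce s).toHom, ?_, ?_⟩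
  · exact (SimpleGraph.Walk.isCycle_map_iff_of_injective Subtype.val_injective).2 hc
  · intro x hx
    simp only [SimpleGraph.Walk.support_map, List.mem_map] at hx
    obtain ⟨y, _, rfl⟩ := hx
    exact y.2

lemma not_acyclic_of_cycle {V : Type} (G : SimpleGraph V) (s : Set V) (v : V) (c : G.Walk v v)
    (hc : c.IsCycle) (h : ∀ x ∈ c.support, x ∈ s) : ¬ (G.induce s).IsAcyclic := by
  intro ha
  apply ha (c.induce s h)
  apply SimpleGraph.Walk.IsCycle.of_map (f := (SimpleGraph.Embedding.induce s).toHom)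
  rw [SimpleGraph.Walk.map_induce]
  exact hc

lemma two_le_dIn_of_cycle {V : Type} [Fintype V] [DecidableEq V] (G : SimpleGraph V)
    [DecidableRel G.Adj] (F : Finset V) (v : V) (c : G.Walk v v) (hc : c.IsCycle)
    (h : ∀ x ∈ c.support, x ∈ F) (x : V) (hx : x ∈ c.support) :
    2 ≤ dIn G F x ∧ (dIn G F x ≤ 2 → ∀ y ∈ F, G.Adj x y → c.toSubgraph.Adj x y) := by
  have h1 := hc.ncard_neighborSet_toSubgraph_eq_two hx
  have h2 : dIn G F x = ({y | y ∈ F ∧ G.Adj x y} : Set V).ncard := by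
    unfold dIn
    rw [← Set.ncard_coe_finset]
    simp
  have h3 : c.toSubgraph.neighborSet x ⊆ {y | y ∈ F ∧ G.Adj x y} := by
    intro y hy
    have hy' : c.toSubgraph.Adj x y := hy
    refine ⟨h y ?_, hy'.adj_sub⟩
    have := hy'.snd_mem
    simpa using this
  have h4 := Set.ncard_le_ncard h3 (Set.toFinite _)
  refine ⟨by omega, fun hle y hy hxy => ?_⟩
  have h5 := Set.eq_of_subset_of_ncard_le h3 (by omega) (Set.toFinite _)
  have : y ∈ c.toSubgraph.neighborSet x := by rw [h5]; exact ⟨hy, hxy⟩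
  exact this

lemma exists_degree_three_nbr (f : ℕ → ℕ) (k : ℕ)
    (hind : ∀ (W : Type) [Fintype W] [DecidableEq W]
        (H : SimpleGraph W) [DecidableRel H.Adj],
        (Finset.univ.filter fun v => H.degree v < 3).card ≤ k - 1 →
        f (k - 1) ≤ Fintype.card W → HasGoodPair H)
    {V : Type} [Fintype V] [DecidableEq V]
    (G : SimpleGraph V) [DecidableRel G.Adj]
    (hB : (Finset.univ.filter fun v => G.degree v ≤ 2).card = k)
    (hno : ¬ HasGoodPair G)
    (hcard : f (k - 1) + 1 ≤ Fintype.card V) (v : V) (hv : G.degree v ≤ 2) :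
    ∃ u, G.Adj v u ∧ G.degree u = 3 := by
  classical
  by_contra! hcon
  apply hno
  apply goodPair_induce G {u | u ≠ v}
  apply hind
  · rw [← hB, ← Finset.card_erase_of_mem (s := Finset.univ.filter fun v => G.degree v ≤ 2) (a := v)
      (by simpa using hv), ← Finset.card_map (Function.Embedding.subtype (· ∈ {u | u ≠ v}))]
    apply Finset.card_le_card
    intro x hx
    simp only [Finset.mem_map, Finset.mem_filter, Finset.mem_univ, true_and] at hx
    obtain ⟨y, hy, rfl⟩ := hx
    rw [degree_induce_eq G _ (Finset.univ.erase v) (by simp) y] at hy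
    have h1 := dIn_erase G Finset.univ v (Finset.mem_univ _) y
    rw [dIn_univ] at h1
    have h2 := hcon y
    have h3 : (y : V) ≠ v := y.2
    simp only [Function.Embedding.subtype_apply, Finset.mem_erase, Finset.mem_filter,
      Finset.mem_univ, true_and]
    refine ⟨h3, ?_⟩
    split_ifs at h1 with ha
    · have := h2 ha
      omega
    · omega
  · have : Fintype.card ({u | u ≠ v} : Set V) = Fintype.card V - 1 := by
      rw [Fintype.card_of_subtype (Finset.univ.erase v) (by simp),
        Finset.card_erase_of_mem (Finset.mem_univ _), Finset.card_univ]
    omega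

lemma exists_big_degree (f : ℕ → ℕ) (k : ℕ)
    (hind : ∀ (W : Type) [Fintype W] [DecidableEq W]
        (H : SimpleGraph W) [DecidableRel H.Adj],
        (Finset.univ.filter fun v => H.degree v < 3).card ≤ k - 1 →
        f (k - 1) ≤ Fintype.card W → HasGoodPair H)
    {V : Type} [Fintype V] [DecidableEq V]
    (G : SimpleGraph V) [DecidableRel G.Adj]
    (hB : (Finset.univ.filter fun v => G.degree v ≤ 2).card = k)
    (hcard : f (k - 1) + 1 ≤ Fintype.card V) :
    ∃ u, 3 ≤ G.degree u := by
  classical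
  by_contra! hcon
  have h1 : (Finset.univ.filter fun v => G.degree v ≤ 2) = Finset.univ := by
    ext x
    have := hcon x
    simp
    omega
  rw [h1, Finset.card_univ] at hB
  apply not_goodPair_bot (Fin (k - 1))
  apply hind
  · exact (Finset.card_le_univ _).trans (by simp)
  · simp
    omega

theorem exists_feasible_cycle (f : ℕ → ℕ) (k : ℕ)
    (hind : ∀ (W : Type) [Fintype W] [DecidableEq W]
        (H : SimpleGraph W) [DecidableRel H.Adj],
        (Finset.univ.filter fun v => H.degree v < 3).card ≤ k - 1 →
        f (k - 1) ≤ Fintype.card W → HasGoodPair H)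
    {V : Type} [Fintype V] [DecidableEq V]
    (G : SimpleGraph V) [DecidableRel G.Adj]
    (h2 : TwoConnected G)
    (hB : (Finset.univ.filter fun v => G.degree v ≤ 2).card = k)
    (hno : ¬ HasGoodPair G)
    (hcard : f (k - 1) + 1 ≤ Fintype.card V) :
    ∃ (v : V) (c : G.Walk v v), c.IsCycle ∧ c.toSubgraph.IsInduced ∧
      (G.induce {x : V | x ∉ c.support}).Connected := by
  classical
  have hprop := exists_degree_three_nbr f k hind G hB hno hcard
  obtain ⟨w, hw⟩ := exists_big_degree f k hind G hB hcard
  have hdeg := two_le_degree G h2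
  -- an initial connected set whose complement has a cycle
  have hinit : ∃ z : V, ¬ (G.induce ((Finset.univ.erase z : Finset V) : Set V)).IsAcyclic := by
    by_contra! hcon
    have hd : ∀ v ∈ (Finset.univ : Finset V), 2 ≤ dIn G Finset.univ v := by
      intro v _
      rw [dIn_univ]
      exact hdeg v
    have hn : 1 < G.degree w := by omega
    rw [← SimpleGraph.card_neighborFinset_eq_degree] at hn
    obtain ⟨a, ha, b, hb, hab⟩ := Finset.one_lt_card.1 hn
    rw [SimpleGraph.mem_neighborFinset] at ha hb
    have h3 := excess_two G Finset.univ hd a w b (by simp) (by simp) ha.ne (by simp) hab.symm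
      hb.ne (hcon a)
    have h4 := excess_two G Finset.univ hd b w a (by simp) (by simp) hb.ne (by simp) hab
      ha.ne (hcon b)
    simp only [dIn_univ] at h3 h4
    omega
  obtain ⟨z, hz⟩ := hinit
  let P : Finset (Finset V) := Finset.univ.filter fun H =>
    (G.induce (H : Set V)).Connected ∧ ¬ (G.induce ((Hᶜ : Finset V) : Set V)).IsAcyclic
  have hPne : P.Nonempty := by
    refine ⟨{z}, ?_⟩
    simp only [P, Finset.mem_filter, Finset.mem_univ, true_and]
    refine ⟨?_, ?_⟩
    · rw [Finset.coe_singleton]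
      have : Subsingleton ({z} : Set V) := inferInstance
      have : Nonempty ({z} : Set V) := inferInstance
      exact SimpleGraph.Connected.mk SimpleGraph.Preconnected.of_subsingleton
    · have : ({z}ᶜ : Finset V) = Finset.univ.erase z := by ext; simp
      rw [this]
      exact hz
  obtain ⟨H, hHP, hmax⟩ := P.exists_max_image Finset.card hPne
  simp only [P, Finset.mem_filter, Finset.mem_univ, true_and] at hHP hmax
  obtain ⟨hconn, hcyc⟩ := hHP
  obtain ⟨F, hF⟩ : ∃ F, F = Hᶜ := ⟨_, rfl⟩
  rw [← hF] at hcyc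
  have hmem : ∀ x, x ∈ F ↔ x ∉ H := by simp [hF]
  -- neighbours of H
  have hNac : ∀ x ∈ H, ∀ h ∈ F, G.Adj x h →
      (G.induce ((F.erase h : Finset V) : Set V)).IsAcyclic := by
    intro x hx h hh hadj
    by_contra hna
    have hle := hmax (insert h H) ⟨?_, ?_⟩
    · rw [Finset.card_insert_of_notMem ((hmem h).1 hh)] at hle
      omega
    · have := G.induce_union_connected hconn.preconnected
        (G.induce_pair_connected_of_adj hadj).preconnected ⟨x, by simp [hx]⟩
      have he : ((insert h H : Finset V) : Set V) = (H : Set V) ∪ {x, h} := by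
        ext y
        simp only [Finset.coe_insert, Set.mem_insert_iff, Finset.mem_coe, Set.mem_union,
          Set.mem_singleton_iff]
        constructor
        · tauto
        · rintro (h | rfl | h) <;> tauto
      rw [he]
      exact this
    · rw [Finset.compl_insert, ← hF]
      exact hna
  obtain ⟨v, c, hc, hcF⟩ := exists_cycle_of_not_acyclic G _ hcyc
  have hcF' : ∀ x ∈ c.support, x ∈ F := fun x hx => by simpa using hcF x hx
  have hNc : ∀ x ∈ H, ∀ h ∈ F, G.Adj x h → h ∈ c.support := by
    intro x hx h hh hadj
    by_contra hn
    refine not_acyclic_of_cycle G _ v c hc ?_ (hNac x hx h hh hadj)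
    intro y hy
    simp only [Finset.coe_erase, Set.mem_sdiff, Finset.mem_coe, Set.mem_singleton_iff]
    exact ⟨hcF' y hy, fun e => hn (e ▸ hy)⟩
  -- degrees in F
  have hdF : ∀ x, (∀ y ∈ H, ¬ G.Adj x y) → dIn G F x = G.degree x := by
    intro x hx
    rw [← dIn_univ]
    unfold dIn
    congr 1
    ext y
    simp only [Finset.mem_filter, Finset.mem_univ, true_and, hmem]
    exact ⟨fun h => h.2, fun h => ⟨fun hy => hx y hy h, h⟩⟩
  have hd : ∀ x ∈ F, 2 ≤ dIn G F x := by
    intro x hx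
    by_cases hN : ∃ y ∈ H, G.Adj x y
    · obtain ⟨y, hy, hxy⟩ := hN
      exact (two_le_dIn_of_cycle G F v c hc hcF' x (hNc y hy x hx hxy.symm)).1
    · push Not at hN
      rw [hdF x hN]
      exact hdeg x
  have hvF : v ∈ F := hcF' v c.start_mem_support
  obtain ⟨p, hp, q, hq, hpq⟩ := Finset.one_lt_card.1 (show 1 < _ from hd v hvF)
  simp only [Finset.mem_filter] at hp hq
  obtain ⟨a, ha⟩ : ∃ a, a ∈ H := by
    obtain ⟨a⟩ := hconn.nonempty
    exact ⟨a, by simpa using a.2⟩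
  have haF : ∀ x ∈ F, a ≠ x := fun x hx e => (hmem x).1 hx (e ▸ ha)
  obtain ⟨x₁, h₁, hx₁, hh₁, -, -, hadj₁⟩ := boundary_edge G h2 (H : Set V) v a p (by simpa using ha)
    (haF v hvF) (by simpa using (hmem p).1 hp.1) hp.2.ne'
  replace hh₁ : h₁ ∈ F := (hmem _).2 (by simpa using hh₁)
  replace hx₁ : x₁ ∈ H := by simpa using hx₁
  obtain ⟨b, hbF, hb⟩ : ∃ b ∈ F, b ≠ h₁ := by
    by_cases h : p = h₁
    · exact ⟨q, hq.1, fun e => hpq (h.trans e.symm)⟩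
    · exact ⟨p, hp.1, h⟩
  obtain ⟨x₂, h₂, hx₂, hh₂, -, h21, hadj₂⟩ := boundary_edge G h2 (H : Set V) h₁ a b
    (by simpa using ha) (haF _ hh₁) (by simpa using (hmem b).1 hbF) hb
  replace hh₂ : h₂ ∈ F := (hmem _).2 (by simpa using hh₂)
  replace hx₂ : x₂ ∈ H := by simpa using hx₂
  have hac₁ := hNac _ hx₁ _ hh₁ hadj₁
  have hac₂ := hNac _ hx₂ _ hh₂ hadj₂
  have e₁ := excess_one G F hd h₁ h₂ hh₁ hh₂ h21 hac₁
  have e₂ := excess_one G F hd h₂ h₁ hh₂ hh₁ h21.symm hac₂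
  have hothers : ∀ x ∈ F, x ≠ h₁ → x ≠ h₂ → dIn G F x = 2 := by
    intro x hx n1 n2
    have i1 := excess_two G F hd h₁ h₂ x hh₁ hh₂ h21 hx n1 n2.symm hac₁
    have i2 := excess_two G F hd h₂ h₁ x hh₂ hh₁ h21.symm hx n2 n1.symm hac₂
    have i3 := hd x hx
    omega
  have hd₁ := hd h₁ hh₁
  by_cases hcase : 3 ≤ dIn G F h₁
  · -- contradiction
    exfalso
    have hNonly : ∀ x ∈ F, x ≠ h₁ → x ≠ h₂ → ∀ y ∈ H, ¬ G.Adj x y := by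
      intro x hx n1 n2 y hy hxy
      have i1 := excess_one G F hd x h₁ hx hh₁ n1.symm (hNac y hy x hx hxy.symm)
      have i2 := hothers x hx n1 n2
      omega
    have hbig : ∀ h ∈ F, ∀ x ∈ H, G.Adj x h → dIn G F h < G.degree h := by
      intro h hh x hx hxh
      rw [← dIn_univ]
      unfold dIn
      apply Finset.card_lt_card
      rw [Finset.ssubset_iff_of_subset (Finset.filter_subset_filter _ (Finset.subset_univ _))]
      exact ⟨x, by simp [hxh.symm], by simp [hmem, hx]⟩
    have hb₁ := hbig _ hh₁ _ hx₁ hadj₁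
    have hb₂ := hbig _ hh₂ _ hx₂ hadj₂
    obtain ⟨x, hx, n1, n2⟩ : ∃ x ∈ F, x ≠ h₁ ∧ x ≠ h₂ := by
      obtain ⟨x, hx, hx2⟩ := Finset.exists_mem_ne (show 1 < _ from hd₁) h₂
      simp only [Finset.mem_filter] at hx
      exact ⟨x, hx.1, hx.2.ne', hx2⟩
    have hdx := hdF x (hNonly x hx n1 n2)
    rw [hothers x hx n1 n2] at hdx
    obtain ⟨u, hxu, hu⟩ := hprop x hdx.ge
    have huF : u ∈ F := (hmem u).2 fun hu' => hNonly x hx n1 n2 u hu' hxu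
    by_cases u1 : u = h₁
    · subst u1; omega
    by_cases u2 : u = h₂
    · subst u2; omega
    have := hothers u huF u1 u2
    rw [hdF u (hNonly u huF u1 u2)] at this
    omega
  · have hall : ∀ x ∈ F, dIn G F x ≤ 2 := by
      intro x hx
      by_cases u1 : x = h₁
      · subst u1; omega
      by_cases u2 : x = h₂
      · subst u2; omega
      exact (hothers x hx u1 u2).le
    have hadjc : ∀ x ∈ c.support, ∀ y ∈ F, G.Adj x y → c.toSubgraph.Adj x y := fun x hx =>
      (two_le_dIn_of_cycle G F v c hc hcF' x hx).2 (hall x (hcF' x hx))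
    have hFc : ∀ x ∈ F, x ∈ c.support := by
      intro x hx
      by_contra hxc
      have hc1 := hNc _ hx₁ _ hh₁ hadj₁
      obtain ⟨s, t, hs, ht, -, -, hst⟩ := boundary_edge G h2 {y | y ∈ F ∧ y ∉ c.support} h₁ x a
        ⟨hx, hxc⟩ (fun e => hxc (e ▸ hc1)) (fun h => (hmem a).1 h.1 ha) (haF _ hh₁)
      by_cases htH : t ∈ H
      · exact hs.2 (hNc t htH s hs.1 hst.symm)
      · have htF := (hmem t).2 htH
        have htc : t ∈ c.support := by
          by_contra h
          exact ht ⟨htF, h⟩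
        have := (hadjc t htc s hs.1 hst.symm).snd_mem
        exact hs.2 (by simpa using this)
    refine ⟨v, c, hc, ?_, ?_⟩
    · intro x hx y hy hxy
      exact hadjc x (by simpa using hx) y (hcF' y (by simpa using hy)) hxy
    · have : {x : V | x ∉ c.support} = (H : Set V) := by
        ext x
        simp only [Set.mem_ofPred_eq, Finset.mem_coe]
        constructor
        · intro h
          by_contra hxH
          exact h (hFc x ((hmem x).2 hxH))
        · intro h h'
          exact (hmem x).1 (hcF' x h') h
      rw [this]
      exact hconn
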